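/- arXiv:2106.11247 — 2 statements merged into one kernel-verified Lean document; each statement's English description precedes it below -/
import Mathlib

section
/- If 𝒞 and 𝒟 are order-equivalent cakes, then M(𝒞) = M(𝒟); i.e., the minimax result of the convex grabbing game depends only on the order type of the cake. -/
open scoped Classical

noncomputable section

/-- Determinant of the pair of vectors `(q - p, r - p)`. -/
def orientDet (p q r : ℝ × ℝ) : ℝ :=
  (q.1 - p.1) * (r.2 - p.2) - (q.2 - p.2) * (r.1 - p.1)

/-- The orientation `∇ p q r` : `+1` for counterclockwise, `-1` for clockwise, `0` collinear. -/
def orient (p q r : ℝ × ℝ) : ℝ := Real.sign (orientDet p q r)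

/-- A set of points is in general position if no three of its points are collinear. -/
def GenPos (C : Set (ℝ × ℝ)) : Prop :=
  ∀ p ∈ C, ∀ q ∈ C, ∀ r ∈ C, p ≠ q → p ≠ r → q ≠ r → orientDet p q r ≠ 0

/-- The extremal points of a finite set `C`. -/
def exPts (C : Finset (ℝ × ℝ)) : Finset (ℝ × ℝ) :=
  C.filter (fun c => c ∉ convexHull ℝ ((C.erase c : Finset (ℝ × ℝ)) : Set (ℝ × ℝ)))

/-- The minimax value (Bob's total, Alice to move) of the convex grabbing game. -/
def gameM (w : ℝ × ℝ → ℕ) (C : Finset (ℝ × ℝ)) : ℕ :=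
  if h : C.card ≤ 1 then 0
  else
    sInf (↑((exPts C).attach.image (fun a =>
      (exPts (C.erase a.1)).attach.sup (fun b =>
        w b.1 + gameM w ((C.erase a.1).erase b.1)))) : Set ℕ)
termination_by C.card
decreasing_by
  have ha : a.1 ∈ C := Finset.mem_of_mem_filter _ a.2
  have hb : b.1 ∈ C.erase a.1 := Finset.mem_of_mem_filter _ b.2
  calc ((C.erase a.1).erase b.1).card
      < (C.erase a.1).card := Finset.card_erase_lt_of_mem hb
    _ ≤ C.card := Finset.card_erase_le

/-- The minimax value of the game when it is Bob's turn to move. -/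
def gameMB (w : ℝ × ℝ → ℕ) (C : Finset (ℝ × ℝ)) : ℕ :=
  (exPts C).sup (fun b => w b + gameM w (C.erase b))


theorem Real.sign_eq_one_iff {x : ℝ} : Real.sign x = 1 ↔ 0 < x := by
  refine ⟨fun h => ?_, Real.sign_of_pos⟩
  rcases lt_trichotomy x 0 with hx | rfl | hx
  · norm_num [Real.sign_of_neg hx] at h
  · simp at h
  · exact hx

theorem Real.sign_eq_neg_one_iff {x : ℝ} : Real.sign x = -1 ↔ x < 0 := by
  rw [← neg_pos, ← Real.sign_eq_one_iff, Real.sign_neg, neg_eq_iff_eq_neg]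

/-- A triangle is spanned by its vertices: `c` is in the convex hull of `{p, q, r}` with positive
barycentric coordinates as soon as `c` lies on the same side of the three directed edges. -/
theorem mem_convexHull_of_orient_eq {p q r c : ℝ × ℝ} (h₀ : orientDet p q c ≠ 0)
    (h₁ : orient p q c = orient q r c) (h₂ : orient q r c = orient r p c) :
    c ∈ convexHull ℝ {p, q, r} := by
  have key : ∃ a b e : ℝ, 0 ≤ a ∧ 0 ≤ b ∧ 0 ≤ e ∧ a + b + e ≠ 0 ∧
      (a + b + e) • c = a • p + b • q + e • r := by
    have hid : (orientDet q r c + orientDet r p c + orientDet p q c) • c =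
        orientDet q r c • p + orientDet r p c • q + orientDet p q c • r := by
      ext <;> simp [orientDet] <;> ring
    unfold orient at h₁ h₂
    rcases lt_or_gt_of_ne h₀ with h | h
    · rw [Real.sign_of_neg h] at h₁
      have h3 := Real.sign_eq_neg_one_iff.mp h₁.symm
      have h4 := Real.sign_eq_neg_one_iff.mp (h₂.symm.trans h₁.symm)
      refine ⟨-orientDet q r c, -orientDet r p c, -orientDet p q c, by linarith, by linarith,
        by linarith, by intro; linarith, ?_⟩
      rw [← neg_add, ← neg_add, neg_smul, hid]
      module
    · rw [Real.sign_of_pos h] at h₁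
      have h3 := Real.sign_eq_one_iff.mp h₁.symm
      have h4 := Real.sign_eq_one_iff.mp (h₂.symm.trans h₁.symm)
      exact ⟨orientDet q r c, orientDet r p c, orientDet p q c, by linarith, by linarith,
        by linarith, by positivity, hid⟩
  obtain ⟨a, b, e, ha, hb, he, hs, hc⟩ := key
  have hpos : 0 < a + b + e := lt_of_le_of_ne (by positivity) hs.symm
  have hmem := (convex_convexHull ℝ {p, q, r}).sum_mem (t := Finset.univ)
    (w := ![a / (a + b + e), b / (a + b + e), e / (a + b + e)]) (z := ![p, q, r])
    (by intro i _; fin_cases i <;> simp <;> positivity)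
    (by simp [Fin.sum_univ_three]; field_simp)
    (by intro i _; fin_cases i <;> exact subset_convexHull ℝ _ (by simp))
  convert hmem using 1
  apply smul_right_injective _ hs
  simp only [Fin.sum_univ_three, hc]
  ext <;> simp <;> field_simp

/-- A point of a triangle on none of the lines through two of its vertices lies on the same side
of the three directed edges. -/
theorem orient_eq_of_mem_convexHull {p q r c : ℝ × ℝ} (hpq : orientDet p q c ≠ 0)
    (hqr : orientDet q r c ≠ 0) (hrp : orientDet r p c ≠ 0)
    (hc : c ∈ convexHull ℝ {p, q, r}) :
    orient p q c = orient q r c ∧ orient q r c = orient r p c := by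
  rw [convexHull_insert (by simp), convexHull_pair] at hc
  simp only [convexJoin, Set.mem_iUnion, Set.mem_singleton_iff, exists_prop, exists_eq_left] at hc
  obtain ⟨z, ⟨s, t, hs, ht, hst, rfl⟩, a, b, ha, hb, hab, rfl⟩ := hc
  obtain rfl : a = 1 - b := by linarith
  obtain rfl : s = 1 - t := by linarith
  set c := (1 - b) • p + b • ((1 - t) • q + t • r) with hcdef
  have e₁ : orientDet p q c = (b * t) * orientDet p q r := by
    simp [orientDet, hcdef]; ring
  have e₂ : orientDet q r c = (1 - b) * orientDet p q r := by
    simp [orientDet, hcdef]; ring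
  have e₃ : orientDet r p c = (b * (1 - t)) * orientDet p q r := by
    simp [orientDet, hcdef]; ring
  have sgn : ∀ x : ℝ, 0 ≤ x → x * orientDet p q r ≠ 0 →
      Real.sign (x * orientDet p q r) = Real.sign (orientDet p q r) := by
    intro x hx hne
    have hx' : 0 < x := lt_of_le_of_ne hx (left_ne_zero_of_mul hne).symm
    rcases lt_or_gt_of_ne (right_ne_zero_of_mul hne) with h | h
    · rw [Real.sign_of_neg h, Real.sign_of_neg (mul_neg_of_pos_of_neg hx' h)]
    · rw [Real.sign_of_pos h, Real.sign_of_pos (mul_pos hx' h)]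
  rw [e₁] at hpq
  rw [e₂] at hqr
  rw [e₃] at hrp
  unfold orient
  rw [e₁, e₂, e₃, sgn _ (by positivity) hpq, sgn _ ha hqr, sgn _ (mul_nonneg hb hs) hrp]
  exact ⟨rfl, rfl⟩

theorem orientDet_eq_zero_of_mem_segment {p q c : ℝ × ℝ} (hc : c ∈ segment ℝ p q) :
    orientDet p q c = 0 := by
  obtain ⟨s, t, -, -, hst, rfl⟩ := hc
  obtain rfl : s = 1 - t := by linarith
  simp [orientDet]
  ring

theorem GenPos.mono {C D : Set (ℝ × ℝ)} (h : GenPos D) (hCD : C ⊆ D) : GenPos C :=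
  fun p hp q hq r hr => h p (hCD hp) q (hCD hq) r (hCD hr)

/-- In general position, being a non-extremal point is a condition on orientations: the point lies
inside a triangle spanned by three other points. -/
theorem mem_convexHull_erase_iff {C : Finset (ℝ × ℝ)} (hC : GenPos (↑C : Set (ℝ × ℝ)))
    {c : ℝ × ℝ} (hc : c ∈ C) :
    c ∈ convexHull ℝ (↑(C.erase c) : Set (ℝ × ℝ)) ↔
      ∃ p ∈ C.erase c, ∃ q ∈ C.erase c, ∃ r ∈ C.erase c, p ≠ q ∧ p ≠ r ∧ q ≠ r ∧
        orient p q c = orient q r c ∧ orient q r c = orient r p c := by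
  have hdet : ∀ p ∈ C.erase c, ∀ q ∈ C.erase c, p ≠ q → orientDet p q c ≠ 0 :=
    fun p hp q hq hpq => hC p (Finset.mem_of_mem_erase hp) q (Finset.mem_of_mem_erase hq) c hc hpq
      (Finset.ne_of_mem_erase hp) (Finset.ne_of_mem_erase hq)
  constructor
  · intro h
    rw [convexHull_eq_union] at h
    simp only [Set.mem_iUnion, exists_prop] at h
    obtain ⟨t, htC, hind, hct⟩ := h
    have htC' : t ⊆ C.erase c := Finset.coe_subset.mp htC
    have hcard : t.card ≤ 3 := by
      have := hind.card_le_finrank_succ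
      have h2 := Submodule.finrank_le (vectorSpan ℝ (Set.range ((↑) : t → ℝ × ℝ)))
      simp at this h2
      omega
    interval_cases hn : t.card
    · simp [Finset.card_eq_zero.mp hn] at hct
    · obtain ⟨p, rfl⟩ := Finset.card_eq_one.mp hn
      simp at hct
      simp [hct] at htC'
    · obtain ⟨p, q, hpq, rfl⟩ := Finset.card_eq_two.mp hn
      simp only [Finset.coe_insert, Finset.coe_singleton, convexHull_pair] at hct
      exact absurd (orientDet_eq_zero_of_mem_segment hct)
        (hdet p (htC' (by simp)) q (htC' (by simp)) hpq)
    · obtain ⟨p, q, r, hpq, hpr, hqr, rfl⟩ := Finset.card_eq_three.mp hn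
      have hp := htC' (show p ∈ _ by simp)
      have hq := htC' (show q ∈ _ by simp)
      have hr := htC' (show r ∈ _ by simp)
      exact ⟨p, hp, q, hq, r, hr, hpq, hpr, hqr, orient_eq_of_mem_convexHull (hdet p hp q hq hpq)
        (hdet q hq r hr hqr) (hdet r hr p hp hpr.symm) (by simpa using hct)⟩
  · rintro ⟨p, hp, q, hq, r, hr, hpq, -, -, h₁, h₂⟩
    refine convexHull_mono ?_ (mem_convexHull_of_orient_eq (hdet p hp q hq hpq) h₁ h₂)
    rintro x (rfl | rfl | rfl) <;> assumption

/-- `π` multiplies the orientations of all triples of distinct points of `C` by `σ`. -/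
def ScalesOrient (π : ℝ × ℝ → ℝ × ℝ) (σ : ℝ) (C : Finset (ℝ × ℝ)) : Prop :=
  ∀ p ∈ C, ∀ q ∈ C, ∀ r ∈ C, p ≠ q → p ≠ r → q ≠ r →
    orient (π p) (π q) (π r) = σ * orient p q r

theorem ScalesOrient.mono {π : ℝ × ℝ → ℝ × ℝ} {σ : ℝ} {C D : Finset (ℝ × ℝ)}
    (h : ScalesOrient π σ D) (hCD : C ⊆ D) : ScalesOrient π σ C :=
  fun p hp q hq r hr => h p (hCD hp) q (hCD hq) r (hCD hr)

theorem Finset.image_erase_of_injOn {α β : Type*} [DecidableEq α] [DecidableEq β] {f : α → β}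
    {s : Finset α} (hf : Set.InjOn f s) {a : α} (ha : a ∈ s) :
    (s.erase a).image f = (s.image f).erase (f a) := by
  ext y
  simp only [Finset.mem_image, Finset.mem_erase]
  constructor
  · rintro ⟨x, ⟨hxa, hx⟩, rfl⟩
    exact ⟨fun h => hxa (hf hx ha h), x, hx, rfl⟩
  · rintro ⟨hne, x, hx, rfl⟩
    exact ⟨x, ⟨fun h => hne (h ▸ rfl), hx⟩, rfl⟩

/-- Extremal points are preserved by bijections that preserve or reverse all orientations. -/
theorem exPts_image {C : Finset (ℝ × ℝ)} {π : ℝ × ℝ → ℝ × ℝ} {σ : ℝ} (hσ : σ ≠ 0)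
    (hC : GenPos (↑C : Set (ℝ × ℝ))) (hD : GenPos (↑(C.image π) : Set (ℝ × ℝ)))
    (hinj : Set.InjOn π C) (hπ : ScalesOrient π σ C) :
    exPts (C.image π) = (exPts C).image π := by
  have key : ∀ c ∈ C, (π c ∈ convexHull ℝ (↑((C.image π).erase (π c)) : Set (ℝ × ℝ)) ↔
      c ∈ convexHull ℝ (↑(C.erase c) : Set (ℝ × ℝ))) := by
    intro c hc
    rw [mem_convexHull_erase_iff hD (Finset.mem_image_of_mem π hc), mem_convexHull_erase_iff hC hc,
      ← Finset.image_erase_of_injOn hinj hc]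
    simp only [Finset.exists_mem_image]
    refine exists_congr fun p => and_congr_right fun hp => exists_congr fun q =>
      and_congr_right fun hq => exists_congr fun r => and_congr_right fun hr => ?_
    obtain ⟨hpc, hp⟩ := Finset.mem_erase.mp hp
    obtain ⟨hqc, hq⟩ := Finset.mem_erase.mp hq
    obtain ⟨hrc, hr⟩ := Finset.mem_erase.mp hr
    rw [hinj.ne_iff hp hq, hinj.ne_iff hp hr, hinj.ne_iff hq hr]
    refine and_congr_right fun hpq => and_congr_right fun hpr => and_congr_right fun hqr => ?_
    rw [hπ p hp q hq c hc hpq hpc hqc, hπ q hq r hr c hc hqr hqc hrc,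
      hπ r hr p hp c hc hpr.symm hrc hpc, mul_right_inj' hσ, mul_right_inj' hσ]
  unfold exPts
  rw [Finset.filter_image]
  congr 1
  exact Finset.filter_congr fun c hc => not_congr (key c hc)

theorem exPts_subset (C : Finset (ℝ × ℝ)) : exPts C ⊆ C := Finset.filter_subset _ _

theorem gameM_of_card_le_one (w : ℝ × ℝ → ℕ) {C : Finset (ℝ × ℝ)} (h : C.card ≤ 1) :
    gameM w C = 0 := by
  rw [gameM, dif_pos h]

/-- Alice moves so as to minimize the value of the game with Bob to move. -/
theorem gameM_eq_sInf_gameMB (w : ℝ × ℝ → ℕ) {C : Finset (ℝ × ℝ)} (h : ¬ C.card ≤ 1) :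
    gameM w C = sInf (↑((exPts C).image fun a => gameMB w (C.erase a)) : Set ℕ) := by
  rw [gameM, dif_neg h]
  congr 2
  conv_rhs => rw [← Finset.attach_image_val (s := exPts C), Finset.image_image]
  refine Finset.image_congr fun a _ => ?_
  exact Finset.sup_attach _ fun b => w b + gameM w ((C.erase a.1).erase b)

theorem gameM_image {C : Finset (ℝ × ℝ)} {w w' : ℝ × ℝ → ℕ} {π : ℝ × ℝ → ℝ × ℝ} {σ : ℝ}
    (hσ : σ ≠ 0) (hC : GenPos (↑C : Set (ℝ × ℝ))) (hD : GenPos (↑(C.image π) : Set (ℝ × ℝ)))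
    (hinj : Set.InjOn π C) (hw : ∀ c ∈ C, w' (π c) = w c) (hπ : ScalesOrient π σ C) :
    gameM w' (C.image π) = gameM w C := by
  induction C using Finset.strongInduction with
  | H C ih =>
  have hcard : (C.image π).card = C.card := Finset.card_image_of_injOn hinj
  by_cases h : C.card ≤ 1
  · rw [gameM_of_card_le_one w h, gameM_of_card_le_one w' (hcard.trans_le h)]
  rw [gameM_eq_sInf_gameMB w h, gameM_eq_sInf_gameMB w' (hcard ▸ h), exPts_image hσ hC hD hinj hπ,
    Finset.image_image]
  congr 2
  refine Finset.image_congr fun a ha => ?_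
  have haC : a ∈ C := exPts_subset C ha
  have hsub := Finset.erase_subset a C
  have hinj' : Set.InjOn π ↑(C.erase a) := hinj.mono (Finset.coe_subset.mpr hsub)
  simp only [Function.comp_apply, gameMB]
  rw [← Finset.image_erase_of_injOn hinj haC,
    exPts_image hσ (hC.mono (Finset.coe_subset.mpr hsub))
      (hD.mono (Finset.coe_subset.mpr (Finset.image_subset_image hsub))) hinj' (hπ.mono hsub),
    Finset.sup_image]
  refine Finset.sup_congr rfl fun b hb => ?_
  have hb' : b ∈ C.erase a := exPts_subset _ hb
  have hsub' : (C.erase a).erase b ⊆ C := (Finset.erase_subset _ _).trans hsub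
  rw [Function.comp_apply, ← Finset.image_erase_of_injOn hinj' hb', hw b (hsub hb'),
    ih _ ((Finset.erase_ssubset hb').trans_subset hsub) (hC.mono (Finset.coe_subset.mpr hsub'))
      (hD.mono (Finset.coe_subset.mpr (Finset.image_subset_image hsub')))
      (hinj.mono (Finset.coe_subset.mpr hsub')) (fun c hc => hw c (hsub' hc)) (hπ.mono hsub')]

/-- Order-equivalent cakes have the same minimax result: if `π` is a bijection
from `𝒞` to `𝒟` preserving weights and multiplying all orientations by a fixed sign
`σ ∈ {−1, +1}`, then `M(𝒞) = M(𝒟)`. -/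
theorem statement3 (𝒞 𝒟 : Finset (ℝ × ℝ)) (w𝒞 w𝒟 : ℝ × ℝ → ℕ)
    (hw𝒞 : ∀ p, w𝒞 p ≤ 1) (hw𝒟 : ∀ p, w𝒟 p ≤ 1)
    (hgp𝒞 : GenPos (↑𝒞 : Set (ℝ × ℝ))) (hgp𝒟 : GenPos (↑𝒟 : Set (ℝ × ℝ)))
    (π : ℝ × ℝ → ℝ × ℝ) (hbij : Set.BijOn π (↑𝒞 : Set (ℝ × ℝ)) (↑𝒟 : Set (ℝ × ℝ)))
    (hw : ∀ c ∈ 𝒞, w𝒟 (π c) = w𝒞 c)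
    (σ : ℝ) (hσ : σ = 1 ∨ σ = -1)
    (hpres : ∀ p ∈ 𝒞, ∀ q ∈ 𝒞, ∀ r ∈ 𝒞, p ≠ q → p ≠ r → q ≠ r →
      orient (π p) (π q) (π r) = σ * orient p q r) :
    gameM w𝒞 𝒞 = gameM w𝒟 𝒟 := by
  have himg : 𝒞.image π = 𝒟 := by
    rw [← Finset.coe_inj, Finset.coe_image, hbij.image_eq]
  subst himg
  have hσ₀ : σ ≠ 0 := by rcases hσ with rfl | rfl <;> norm_num
  exact (gameM_image hσ₀ hgp𝒞 hgp𝒟 hbij.injOn hw hpres).symm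

end
end

section
/- For every x ∈ ℕ there exists an odd-sized cake 𝒞 such that M(𝒞) − (R(𝒞) − M(𝒞)) ≥ x; that is, with optimal play on an odd-sized cake, Bob can obtain more red points than Alice by an arbitrarily large margin. -/
open scoped Classical

noncomputable section

/-! ### General facts on the game -/

/-- A point at which a linear functional has a strict maximum is extremal. -/
lemma mem_exPts_of_functional {S : Finset (ℝ × ℝ)} {c : ℝ × ℝ} (hc : c ∈ S) (α β : ℝ)
    (h : ∀ p ∈ S, p ≠ c → α * p.1 + β * p.2 < α * c.1 + β * c.2) : c ∈ exPts S := by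
  refine Finset.mem_filter.2 ⟨hc, fun hmem => ?_⟩
  have hlin : IsLinearMap ℝ (fun p : ℝ × ℝ => α * p.1 + β * p.2) :=
    ⟨fun p q => by simp; ring, fun a p => by simp; ring⟩
  have hsub : convexHull ℝ ((S.erase c : Finset (ℝ × ℝ)) : Set (ℝ × ℝ)) ⊆
      {p | α * p.1 + β * p.2 < α * c.1 + β * c.2} := by
    refine convexHull_min (fun p hp => ?_) (convex_halfSpace_lt hlin _)
    have hp' := Finset.mem_erase.1 (Finset.mem_coe.1 hp)
    exact h p hp'.2 hp'.1
  exact lt_irrefl (α * c.1 + β * c.2) (hsub hmem)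

/-- A point of a nondegenerate triangle spanned by other points is not extremal. -/
lemma not_mem_exPts_of_triangle {S : Finset (ℝ × ℝ)} {c p q r : ℝ × ℝ}
    (hp : p ∈ S.erase c) (hq : q ∈ S.erase c) (hr : r ∈ S.erase c)
    (h₁ : 0 < orientDet p q c) (h₂ : 0 < orientDet q r c) (h₃ : 0 < orientDet r p c) :
    c ∉ exPts S := by
  intro hc
  refine (Finset.mem_filter.1 hc).2 ?_
  set d := orientDet p q c + orientDet q r c + orientDet r p c with hd
  have hd0 : 0 < d := by positivity
  have hcomb : c = (orientDet q r c / d) • p + (orientDet r p c / d) • q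
      + (orientDet p q c / d) • r := by
    ext
    · simp only [Prod.fst_add, Prod.smul_fst, smul_eq_mul]
      field_simp
      simp only [hd, orientDet]
      ring
    · simp only [Prod.snd_add, Prod.smul_snd, smul_eq_mul]
      field_simp
      simp only [hd, orientDet]
      ring
  have hconv := convex_convexHull ℝ ((S.erase c : Finset (ℝ × ℝ)) : Set (ℝ × ℝ))
  have hsum : orientDet q r c / d + orientDet r p c / d + orientDet p q c / d = 1 := by
    field_simp
    rw [hd]; ring
  have key := hconv.sum_mem (t := Finset.univ)
    (w := ![orientDet q r c / d, orientDet r p c / d, orientDet p q c / d])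
    (z := ![p, q, r]) ?_ ?_ ?_
  · simpa [Fin.sum_univ_three, ← hcomb] using key
  · intro i _
    fin_cases i <;> simp <;> positivity
  · simpa [Fin.sum_univ_three] using hsum
  · intro i _
    fin_cases i
    · exact subset_convexHull ℝ _ hp
    · exact subset_convexHull ℝ _ hq
    · exact subset_convexHull ℝ _ hr

lemma exPts_nonempty {S : Finset (ℝ × ℝ)} (hS : S.Nonempty) : (exPts S).Nonempty := by
  have hcomp : IsCompact (convexHull ℝ (S : Set (ℝ × ℝ))) :=
    S.finite_toSet.isCompact_convexHull ℝ
  obtain ⟨c, hc⟩ := hcomp.extremePoints_nonempty (hS.to_set.convexHull)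
  refine ⟨c, Finset.mem_filter.2 ⟨extremePoints_convexHull_subset hc, fun hmem => ?_⟩⟩
  have hc' := ((convex_convexHull ℝ _).mem_extremePoints_iff_mem_sdiff_convexHull_sdiff.1 hc).2
  refine hc' (convexHull_mono ?_ hmem)
  intro p hp
  have hp' := Finset.mem_erase.1 (Finset.mem_coe.1 hp)
  exact ⟨subset_convexHull ℝ _ hp'.2, hp'.1⟩

lemma le_gameM {w : ℝ × ℝ → ℕ} {S : Finset (ℝ × ℝ)} {m : ℕ} (hS : S.Nonempty)
    (h : ∀ a ∈ exPts S, m ≤ gameMB w (S.erase a)) : m ≤ gameM w S := by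
  rw [gameM]
  split_ifs with hcard
  · obtain ⟨a, ha⟩ := exPts_nonempty hS
    have he : S.erase a = ∅ := by
      have := Finset.card_erase_of_mem (Finset.mem_of_mem_filter _ ha)
      exact Finset.card_eq_zero.1 (by omega)
    simpa [he, gameMB, exPts] using h a ha
  · refine le_csInf ?_ ?_
    · exact_mod_cast (exPts_nonempty hS).attach.image _
    · rintro _ hb
      obtain ⟨a, -, rfl⟩ := Finset.mem_image.1 (Finset.mem_coe.1 hb)
      rw [Finset.sup_attach (exPts (S.erase a.1))
        (fun b => w b + gameM w ((S.erase a.1).erase b))]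
      exact h a.1 a.2

lemma le_gameMB {w : ℝ × ℝ → ℕ} {S : Finset (ℝ × ℝ)} {b : ℝ × ℝ} (hb : b ∈ exPts S) :
    w b + gameM w (S.erase b) ≤ gameMB w S :=
  Finset.le_sup (f := fun b => w b + gameM w (S.erase b)) hb

/-- With Alice to move on `S`, Bob can collect at least `v` more weight than Alice. -/
def AliceMargin (w : ℝ × ℝ → ℕ) (S : Finset (ℝ × ℝ)) (v : ℤ) : Prop :=
  v + ((∑ p ∈ S, w p : ℕ) : ℤ) ≤ 2 * (gameM w S : ℤ)

/-- With Bob to move on `S`, Bob can collect at least `v` more weight than Alice. -/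
def BobMargin (w : ℝ × ℝ → ℕ) (S : Finset (ℝ × ℝ)) (v : ℤ) : Prop :=
  v + ((∑ p ∈ S, w p : ℕ) : ℤ) ≤ 2 * (gameMB w S : ℤ)

section Margin

variable {w : ℝ × ℝ → ℕ} {S : Finset (ℝ × ℝ)} {v : ℤ}

lemma AliceMargin.mono {v' : ℤ} (h : AliceMargin w S v) (hv : v' ≤ v) : AliceMargin w S v' := by
  unfold AliceMargin at *; omega

lemma BobMargin.mono {v' : ℤ} (h : BobMargin w S v) (hv : v' ≤ v) : BobMargin w S v' := by
  unfold BobMargin at *; omega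

lemma aliceMargin_empty (hv : v ≤ 0) : AliceMargin w ∅ v := by
  simp only [AliceMargin, Finset.sum_empty]; omega

lemma aliceMargin_of_forall (hS : S.Nonempty)
    (h : ∀ a ∈ exPts S, BobMargin w (S.erase a) (v + w a)) : AliceMargin w S v := by
  unfold AliceMargin
  have key : (v + ((∑ p ∈ S, w p : ℕ) : ℤ) + 1).toNat / 2 ≤ gameM w S := by
    refine le_gameM hS fun a ha => ?_
    have h₁ := h a ha
    have h₂ := Finset.add_sum_erase S w (Finset.mem_of_mem_filter _ ha)
    unfold BobMargin at h₁
    omega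
  omega

lemma BobMargin.of_move {b : ℝ × ℝ} (hb : b ∈ exPts S)
    (h : AliceMargin w (S.erase b) (v - w b)) : BobMargin w S v := by
  unfold BobMargin AliceMargin at *
  have h₁ := le_gameMB (w := w) hb
  have h₂ := Finset.add_sum_erase S w (Finset.mem_of_mem_filter _ hb)
  omega

lemma bobMargin_of_weight_eq_zero (h : ∀ p ∈ S, w p = 0) (hv : v ≤ 0) : BobMargin w S v := by
  unfold BobMargin
  rw [Finset.sum_eq_zero h]
  omega

end Margin

lemma exPts_erase {S : Finset (ℝ × ℝ)} {a p : ℝ × ℝ} (hp : p ∈ exPts S) (hpa : p ≠ a) :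
    p ∈ exPts (S.erase a) := by
  have hp' := Finset.mem_filter.1 hp
  refine Finset.mem_filter.2 ⟨Finset.mem_erase.2 ⟨hpa, hp'.1⟩, fun hmem => hp'.2 ?_⟩
  refine convexHull_mono ?_ hmem
  exact_mod_cast Finset.erase_subset_erase p (Finset.erase_subset a S)

/-- If all red points are extremal, they are shared almost evenly. -/
lemma margin_of_red_extremal {w : ℝ × ℝ → ℕ} (hw : ∀ p, w p ≤ 1) (S : Finset (ℝ × ℝ))
    (h : ∀ p ∈ S, w p = 1 → p ∈ exPts S) : AliceMargin w S (-1) ∧ BobMargin w S 0 := by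
  induction S using Finset.strongInduction with
  | H S ih =>
    have step : ∀ a ∈ S, AliceMargin w (S.erase a) (-1) ∧ BobMargin w (S.erase a) 0 :=
      fun a ha => ih _ (Finset.erase_ssubset ha) fun p hp hp1 =>
        exPts_erase (h p (Finset.mem_of_mem_erase hp) hp1) (Finset.ne_of_mem_erase hp)
    constructor
    · rcases S.eq_empty_or_nonempty with rfl | hS
      · exact aliceMargin_empty (by norm_num)
      · refine aliceMargin_of_forall hS fun a ha => ?_
        have := hw a
        exact (step a (Finset.mem_of_mem_filter _ ha)).2.mono (by omega)
    · by_cases hred : ∃ p ∈ S, w p = 1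
      · obtain ⟨p, hp, hp1⟩ := hred
        exact .of_move (h p hp hp1) (by simpa [hp1] using (step p hp).1)
      · push Not at hred
        refine bobMargin_of_weight_eq_zero (fun p hp => ?_) le_rfl
        have := hw p
        have := hred p hp
        omega

/-! ### The three chains -/

/-- The three chains of points, obtained from one another by a linear map of order three. -/
def chainPt (r : Fin 3) (t : ℝ) : ℝ × ℝ :=
  ![(1 - t, t ^ 2), (-t ^ 2, 1 - t - t ^ 2), (t ^ 2 + t - 1, t - 1)] r

lemma chainPt_zero (t : ℝ) : chainPt 0 t = (1 - t, t ^ 2) := rfl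
lemma chainPt_one (t : ℝ) : chainPt 1 t = (-t ^ 2, 1 - t - t ^ 2) := rfl
lemma chainPt_two (t : ℝ) : chainPt 2 t = (t ^ 2 + t - 1, t - 1) := rfl

lemma chainPt_add_one (r : Fin 3) (t : ℝ) :
    chainPt (r + 1) t = (-(chainPt r t).2, (chainPt r t).1 - (chainPt r t).2) := by
  fin_cases r
  · simp [chainPt_zero, chainPt_one]
  · change chainPt 2 t = _
    simp only [chainPt_two, Fin.mk_one, chainPt_one, Prod.mk.injEq]
    constructor <;> ring
  · change chainPt 0 t = (-(chainPt 2 t).2, (chainPt 2 t).1 - (chainPt 2 t).2)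
    simp only [chainPt_zero, chainPt_two, Prod.mk.injEq]
    constructor <;> ring

lemma orientDet_chainPt_add_one (a b c : Fin 3) (s t u : ℝ) :
    orientDet (chainPt (a + 1) s) (chainPt (b + 1) t) (chainPt (c + 1) u) =
      orientDet (chainPt a s) (chainPt b t) (chainPt c u) := by
  simp only [chainPt_add_one, orientDet]
  ring

lemma orientDet_chainPt_add (d a b c : Fin 3) (s t u : ℝ) :
    orientDet (chainPt (a + d) s) (chainPt (b + d) t) (chainPt (c + d) u) =
      orientDet (chainPt a s) (chainPt b t) (chainPt c u) := by
  fin_cases d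
  · simp
  · exact orientDet_chainPt_add_one a b c s t u
  · have h : ∀ e : Fin 3, e + 2 = e + 1 + 1 := by decide
    change orientDet (chainPt (a + 2) s) (chainPt (b + 2) t) (chainPt (c + 2) u) = _
    rw [h, h, h, orientDet_chainPt_add_one, orientDet_chainPt_add_one]

lemma orientDet_chainPt (r b c d : Fin 3) (s t u : ℝ) :
    orientDet (chainPt (r + b) s) (chainPt (r + c) t) (chainPt (r + d) u) =
      orientDet (chainPt b s) (chainPt c t) (chainPt d u) := by
  rw [add_comm r, add_comm r, add_comm r, orientDet_chainPt_add]

lemma orientDet_same_neg (r : Fin 3) {s t u : ℝ} (hst : s < t) (htu : t < u) :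
    orientDet (chainPt r s) (chainPt r t) (chainPt r u) < 0 := by
  have h := orientDet_chainPt r 0 0 0 s t u
  simp only [add_zero] at h
  rw [h]
  have : orientDet (chainPt 0 s) (chainPt 0 t) (chainPt 0 u) = -((t - s) * (u - s) * (u - t)) := by
    simp only [orientDet, chainPt_zero]; ring
  rw [this, neg_lt_zero]
  exact mul_pos (mul_pos (by linarith) (by linarith)) (by linarith)

lemma orientDet_next_pos (r : Fin 3) {s t u : ℝ} (hs : s ∈ Set.Ico (0 : ℝ) (1 / 10))
    (ht : t ∈ Set.Ico (0 : ℝ) (1 / 10)) (hu : u ∈ Set.Ico (0 : ℝ) (1 / 10)) (hst : s < t) :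
    0 < orientDet (chainPt r s) (chainPt (r + 1) u) (chainPt r t) := by
  have h := orientDet_chainPt r 0 1 0 s u t
  simp only [add_zero] at h
  rw [h]
  obtain ⟨hs0, hs1⟩ := hs
  obtain ⟨ht0, ht1⟩ := ht
  obtain ⟨hu0, hu1⟩ := hu
  have : orientDet (chainPt 0 s) (chainPt 1 u) (chainPt 0 t) =
      (t - s) * ((1 - u - u ^ 2 - s ^ 2) - (1 - s + u ^ 2) * (s + t)) := by
    simp only [orientDet, chainPt_zero, chainPt_one]; ring
  rw [this]
  refine mul_pos (by linarith) ?_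
  have h1 : u ^ 2 ≤ 1 / 100 := by nlinarith
  have h2 : s ^ 2 ≤ 1 / 100 := by nlinarith
  nlinarith [mul_nonneg hs0 (add_nonneg hs0 ht0)]

lemma orientDet_prev_pos (r : Fin 3) {s t u : ℝ} (hs : s ∈ Set.Ico (0 : ℝ) (1 / 10))
    (ht : t ∈ Set.Ico (0 : ℝ) (1 / 10)) (hu : u ∈ Set.Ico (0 : ℝ) (1 / 10)) (hst : s < t) :
    0 < orientDet (chainPt (r + 2) u) (chainPt r s) (chainPt r t) := by
  have h := orientDet_chainPt r 2 0 0 u s t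
  simp only [add_zero] at h
  rw [h]
  obtain ⟨hs0, hs1⟩ := hs
  obtain ⟨ht0, ht1⟩ := ht
  obtain ⟨hu0, hu1⟩ := hu
  have : orientDet (chainPt 2 u) (chainPt 0 s) (chainPt 0 t) =
      (t - s) * ((2 - s - u - u ^ 2) * (s + t) + (s ^ 2 + 1 - u)) := by
    simp only [orientDet, chainPt_zero, chainPt_two]; ring
  rw [this]
  refine mul_pos (by linarith) ?_
  have h1 : u ^ 2 ≤ 1 / 100 := by nlinarith
  have := mul_nonneg (show (0 : ℝ) ≤ 2 - s - u - u ^ 2 by linarith) (add_nonneg hs0 ht0)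
  nlinarith [sq_nonneg s]

lemma orientDet_triple_pos (r : Fin 3) {s t u : ℝ} (hs : s ∈ Set.Ico (0 : ℝ) (1 / 10))
    (ht : t ∈ Set.Ico (0 : ℝ) (1 / 10)) (hu : u ∈ Set.Ico (0 : ℝ) (1 / 10)) :
    0 < orientDet (chainPt r s) (chainPt (r + 1) t) (chainPt (r + 2) u) := by
  have h := orientDet_chainPt r 0 1 2 s t u
  simp only [add_zero] at h
  rw [h]
  obtain ⟨hs0, hs1⟩ := hs
  obtain ⟨ht0, ht1⟩ := ht
  obtain ⟨hu0, hu1⟩ := hu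
  simp only [orientDet, chainPt_zero, chainPt_one, chainPt_two]
  have h1 : u ^ 2 ≤ 1 / 100 := by nlinarith
  have h2 : s ^ 2 ≤ 1 / 100 := by nlinarith
  have h3 : t ^ 2 ≤ 1 / 100 := by nlinarith
  have a1 : 9/10 ≤ 1 - s + t ^ 2 := by nlinarith [sq_nonneg t]
  have a2 : 9/10 ≤ 1 + s ^ 2 - u := by nlinarith [sq_nonneg s]
  have a3 : 3/4 ≤ 1 - t - t ^ 2 - s ^ 2 := by nlinarith
  have a4 : 3/2 ≤ 2 - s - u - u ^ 2 := by nlinarith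
  nlinarith [mul_nonneg (sub_nonneg.2 a1) (sub_nonneg.2 a2),
    mul_nonneg (sub_nonneg.2 a3) (sub_nonneg.2 a4)]

/-- The functional `(α, β)` takes a larger value at `p` than at `q`. -/
def FunctionalLT (α β : ℝ) (q p : ℝ × ℝ) : Prop := α * q.1 + β * q.2 < α * p.1 + β * p.2

lemma functionalLT_chainPt_add_one {α β s t : ℝ} (r q : Fin 3) :
    FunctionalLT (-α - β) α (chainPt (r + 1) s) (chainPt (q + 1) t) ↔
      FunctionalLT α β (chainPt r s) (chainPt q t) := by
  simp only [FunctionalLT, chainPt_add_one]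
  ring_nf

lemma fin_three_induction {P : Fin 3 → Prop} (zero : P 0) (step : ∀ r, P r → P (r + 1))
    (r : Fin 3) : P r := by
  fin_cases r
  · exact zero
  · exact step 0 zero
  · exact step 1 (step 0 zero)

/-- Some functional decreases along a chain and is smaller on the other chains. -/
lemma exists_functional_head (r : Fin 3) : ∃ α β : ℝ,
    ∀ t ∈ Set.Ico (0 : ℝ) (1 / 10), ∀ s ∈ Set.Ico (0 : ℝ) (1 / 10),
      (t < s → FunctionalLT α β (chainPt r s) (chainPt r t)) ∧
      FunctionalLT α β (chainPt (r + 1) s) (chainPt r t) ∧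
      FunctionalLT α β (chainPt (r + 2) s) (chainPt r t) := by
  induction r using fin_three_induction with
  | zero =>
    refine ⟨1, 0, fun t ⟨ht0, ht1⟩ s ⟨hs0, hs1⟩ => ?_⟩
    simp only [zero_add, chainPt_zero, chainPt_one, chainPt_two, FunctionalLT]
    exact ⟨fun h => by linarith, by nlinarith, by nlinarith⟩
  | step r ih =>
    obtain ⟨α, β, h⟩ := ih
    refine ⟨-α - β, α, fun t ht s hs => ?_⟩
    rw [add_right_comm r 1 2]
    simpa only [functionalLT_chainPt_add_one] using h t ht s hs

/-- Some functional increases along a chain and is smaller on the previous chain. -/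
lemma exists_functional_tail (r : Fin 3) : ∃ α β : ℝ,
    ∀ t ∈ Set.Ico (0 : ℝ) (1 / 10), ∀ s ∈ Set.Ico (0 : ℝ) (1 / 10),
      (s < t → FunctionalLT α β (chainPt r s) (chainPt r t)) ∧
      FunctionalLT α β (chainPt (r + 2) s) (chainPt r t) := by
  induction r using fin_three_induction with
  | zero =>
    refine ⟨0, 1, fun t ⟨ht0, ht1⟩ s ⟨hs0, hs1⟩ => ?_⟩
    simp only [zero_add, chainPt_zero, chainPt_two, FunctionalLT]
    exact ⟨fun h => by nlinarith, by nlinarith⟩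
  | step r ih =>
    obtain ⟨α, β, h⟩ := ih
    refine ⟨-α - β, α, fun t ht s hs => ?_⟩
    rw [add_right_comm r 1 2]
    simpa only [functionalLT_chainPt_add_one] using h t ht s hs

/-- Each point of a chain is exposed relative to that chain and the next one. -/
lemma exists_functional_tangent (r : Fin 3) {t : ℝ} (ht : t ∈ Set.Ico (0 : ℝ) (1 / 10)) :
    ∃ α β : ℝ, ∀ s ∈ Set.Ico (0 : ℝ) (1 / 10),
      (s ≠ t → FunctionalLT α β (chainPt r s) (chainPt r t)) ∧
      FunctionalLT α β (chainPt (r + 1) s) (chainPt r t) := by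
  induction r using fin_three_induction with
  | zero =>
    obtain ⟨ht0, ht1⟩ := ht
    refine ⟨-2 * t, -1, fun s ⟨hs0, hs1⟩ => ?_⟩
    simp only [zero_add, chainPt_zero, chainPt_one, FunctionalLT]
    refine ⟨fun h => ?_, ?_⟩
    · have := sq_pos_of_ne_zero (sub_ne_zero.2 h)
      nlinarith
    · have : s ^ 2 ≤ 1 / 100 := by nlinarith
      nlinarith
  | step r ih =>
    obtain ⟨α, β, h⟩ := ih
    refine ⟨-α - β, α, fun s hs => ?_⟩
    simpa only [functionalLT_chainPt_add_one] using h s hs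

/-! ### The cake -/

/-- A strictly increasing sequence of parameters in `[0, 1/10)`. -/
def chainParam (i : ℕ) : ℝ := 1 / 10 - 1 / (i + 10)

lemma chainParam_strictMono : StrictMono chainParam := by
  intro i j hij
  have h : (i : ℝ) < j := by exact_mod_cast hij
  have := one_div_lt_one_div_of_lt (show (0 : ℝ) < i + 10 by positivity)
    (show (i : ℝ) + 10 < j + 10 by linarith)
  unfold chainParam
  linarith

lemma chainParam_mem (i : ℕ) : chainParam i ∈ Set.Ico (0 : ℝ) (1 / 10) := by
  constructor
  · have := chainParam_strictMono.monotone (Nat.zero_le i)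
    simpa [chainParam] using this
  · have : (0 : ℝ) < 1 / (i + 10) := by positivity
    unfold chainParam
    linarith

/-- The `i`-th point of the `r`-th chain. -/
def cakePt (q : Fin 3 × ℕ) : ℝ × ℝ := chainPt q.1 (chainParam q.2)

lemma FunctionalLT.ne {α β : ℝ} {p q : ℝ × ℝ} (h : FunctionalLT α β p q) : p ≠ q := by
  rintro rfl
  exact lt_irrefl _ h

lemma fin_three_cases (r s : Fin 3) : s = r ∨ s = r + 1 ∨ s = r + 2 := by
  revert r s; decide

lemma fin_three_add_one_add_two (r : Fin 3) : r + 1 + 2 = r := by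
  revert r; decide

lemma cakePt_injective : Function.Injective cakePt := by
  rintro ⟨r, i⟩ ⟨s, j⟩ h
  obtain ⟨α, β, hf⟩ := exists_functional_head r
  have hij := hf _ (chainParam_mem i) _ (chainParam_mem j)
  have hji := hf _ (chainParam_mem j) _ (chainParam_mem i)
  simp only [cakePt] at h
  rcases fin_three_cases r s with rfl | rfl | rfl
  · rcases lt_trichotomy i j with hlt | rfl | hlt
    · exact absurd h.symm (hij.1 (chainParam_strictMono hlt)).ne
    · rfl
    · exact absurd h (hji.1 (chainParam_strictMono hlt)).ne
  · exact absurd h.symm hij.2.1.ne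
  · exact absurd h.symm hij.2.2.ne

/-- The indexing of the points as an embedding. -/
def cakeEmb : Fin 3 × ℕ ↪ ℝ × ℝ := ⟨cakePt, cakePt_injective⟩

/-- The points of odd index are red. -/
def cakeWeight (p : ℝ × ℝ) : ℕ := if ∃ q : Fin 3 × ℕ, Odd q.2 ∧ cakePt q = p then 1 else 0

lemma cakeWeight_le_one (p : ℝ × ℝ) : cakeWeight p ≤ 1 := by
  unfold cakeWeight; split_ifs <;> simp

lemma cakeWeight_cakeEmb (q : Fin 3 × ℕ) : cakeWeight (cakeEmb q) = q.2 % 2 := by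
  have h : (∃ q' : Fin 3 × ℕ, Odd q'.2 ∧ cakePt q' = cakeEmb q) ↔ Odd q.2 :=
    ⟨fun ⟨q', hq', he⟩ => cakePt_injective he ▸ hq', fun h => ⟨q, h, rfl⟩⟩
  unfold cakeWeight
  rw [if_congr h rfl rfl]
  split_ifs with ho
  · exact (Nat.odd_iff.1 ho).symm
  · exact (Nat.even_iff.1 (Nat.not_odd_iff_even.1 ho)).symm

/-- The index `q` is extremal in the index set `S`. -/
def IndexExtremal (S : Finset (Fin 3 × ℕ)) (q : Fin 3 × ℕ) : Prop :=
  cakeEmb q ∈ exPts (S.map cakeEmb)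

lemma indexExtremal_of_functional {S : Finset (Fin 3 × ℕ)} {q : Fin 3 × ℕ} (hq : q ∈ S)
    {α β : ℝ} (h : ∀ p ∈ S, p ≠ q → FunctionalLT α β (cakePt p) (cakePt q)) :
    IndexExtremal S q := by
  refine mem_exPts_of_functional (Finset.mem_map_of_mem _ hq) α β ?_
  intro p hp hne
  obtain ⟨q', hq', rfl⟩ := Finset.mem_map.1 hp
  exact h q' hq' fun he => hne (he ▸ rfl)

lemma indexExtremal_head {S : Finset (Fin 3 × ℕ)} {r : Fin 3} {i : ℕ} (hq : (r, i) ∈ S)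
    (h : ∀ j, (r, j) ∈ S → i ≤ j) : IndexExtremal S (r, i) := by
  obtain ⟨α, β, hf⟩ := exists_functional_head r
  refine indexExtremal_of_functional hq (α := α) (β := β) ?_
  rintro ⟨s, j⟩ hp hne
  have := hf _ (chainParam_mem i) _ (chainParam_mem j)
  rcases fin_three_cases r s with rfl | rfl | rfl
  · refine this.1 (chainParam_strictMono (lt_of_le_of_ne (h j hp) ?_))
    rintro rfl
    exact hne rfl
  · exact this.2.1
  · exact this.2.2

lemma indexExtremal_tail {S : Finset (Fin 3 × ℕ)} {r : Fin 3} {i : ℕ} (hq : (r + 1, i) ∈ S)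
    (hS : ∀ p ∈ S, p.1 = r ∨ p.1 = r + 1) (h : ∀ j, (r + 1, j) ∈ S → j ≤ i) :
    IndexExtremal S (r + 1, i) := by
  obtain ⟨α, β, hf⟩ := exists_functional_tail (r + 1)
  refine indexExtremal_of_functional hq (α := α) (β := β) ?_
  rintro ⟨s, j⟩ hp hne
  have := hf _ (chainParam_mem i) _ (chainParam_mem j)
  rw [fin_three_add_one_add_two] at this
  rcases hS _ hp with hs | hs <;> obtain rfl : s = _ := hs
  · exact this.2
  · refine this.1 (chainParam_strictMono (lt_of_le_of_ne (h j hp) ?_))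
    rintro rfl
    exact hne rfl

lemma indexExtremal_tangent {S : Finset (Fin 3 × ℕ)} {r : Fin 3} {i : ℕ} (hq : (r, i) ∈ S)
    (hS : ∀ p ∈ S, p.1 = r ∨ p.1 = r + 1) : IndexExtremal S (r, i) := by
  obtain ⟨α, β, hf⟩ := exists_functional_tangent r (chainParam_mem i)
  refine indexExtremal_of_functional hq (α := α) (β := β) ?_
  rintro ⟨s, j⟩ hp hne
  have := hf _ (chainParam_mem j)
  rcases hS _ hp with hs | hs <;> obtain rfl : s = _ := hs
  · refine this.1 (chainParam_strictMono.injective.ne ?_)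
    rintro rfl
    exact hne rfl
  · exact this.2

lemma not_indexExtremal_of_triangle {S : Finset (Fin 3 × ℕ)} {c p q r : Fin 3 × ℕ}
    (hp : p ∈ S.erase c) (hq : q ∈ S.erase c) (hr : r ∈ S.erase c)
    (h₁ : 0 < orientDet (cakePt p) (cakePt q) (cakePt c))
    (h₂ : 0 < orientDet (cakePt q) (cakePt r) (cakePt c))
    (h₃ : 0 < orientDet (cakePt r) (cakePt p) (cakePt c)) : ¬ IndexExtremal S c := by
  have hmem : ∀ x ∈ S.erase c, cakePt x ∈ (S.map cakeEmb).erase (cakeEmb c) := by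
    intro x hx
    rw [← Finset.map_erase]
    exact Finset.mem_map_of_mem cakeEmb hx
  exact not_mem_exPts_of_triangle (hmem p hp) (hmem q hq) (hmem r hr) h₁ h₂ h₃

lemma orientDet_rotate (p q r : ℝ × ℝ) : orientDet q r p = orientDet p q r := by
  simp only [orientDet]; ring

/-- While all three chains are present, only the first point of a chain is extremal. -/
lemma not_indexExtremal_of_three {S : Finset (Fin 3 × ℕ)} {r : Fin 3} {i j k l : ℕ} (hij : i < j)
    (hi : (r, i) ∈ S) (hk : (r + 1, k) ∈ S) (hl : (r + 2, l) ∈ S) : ¬ IndexExtremal S (r, j) := by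
  have ht := chainParam_strictMono hij
  refine not_indexExtremal_of_triangle (p := (r, i)) (q := (r + 1, k)) (r := (r + 2, l))
    (by simp [hi, hij.ne]) (by simp [hk]) (by simp [hl]) ?_ ?_ ?_
  · exact orientDet_next_pos r (chainParam_mem i) (chainParam_mem j) (chainParam_mem k) ht
  · rw [orientDet_rotate]
    exact orientDet_triple_pos r (chainParam_mem j) (chainParam_mem k) (chainParam_mem l)
  · exact orientDet_prev_pos r (chainParam_mem i) (chainParam_mem j) (chainParam_mem l) ht

/-- While the previous chain is present, interior points of a chain are not extremal. -/
lemma not_indexExtremal_of_between {S : Finset (Fin 3 × ℕ)} {r : Fin 3} {i j k l : ℕ}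
    (hij : i < j) (hjk : j < k) (hi : (r + 1, i) ∈ S) (hk : (r + 1, k) ∈ S) (hl : (r, l) ∈ S) :
    ¬ IndexExtremal S (r + 1, j) := by
  have hij' := chainParam_strictMono hij
  have hjk' := chainParam_strictMono hjk
  have h₁ := orientDet_prev_pos (r + 1) (chainParam_mem i) (chainParam_mem j)
    (chainParam_mem l) hij'
  have h₂ := orientDet_prev_pos (r + 1) (chainParam_mem j) (chainParam_mem k)
    (chainParam_mem l) hjk'
  have h₃ := orientDet_same_neg (r + 1) hij' hjk'
  rw [fin_three_add_one_add_two] at h₁ h₂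
  refine not_indexExtremal_of_triangle (p := (r, l)) (q := (r + 1, i)) (r := (r + 1, k))
    (by simp [hl]) (by simp [hi, hij.ne]) (by simp [hk, hjk.ne']) h₁ ?_ ?_
  · simp only [cakePt]
    simp only [orientDet] at h₃ ⊢
    linarith
  · rwa [← orientDet_rotate, ← orientDet_rotate] at h₂

/-! ### General position -/

lemma orientDet_swap (p q r : ℝ × ℝ) : orientDet q p r = -orientDet p q r := by
  simp only [orientDet]; ring

lemma orientDet_cakePt_same_ne_zero (r : Fin 3) {i j k : ℕ} (hij : i ≠ j) (hik : i ≠ k)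
    (hjk : j ≠ k) : orientDet (cakePt (r, i)) (cakePt (r, j)) (cakePt (r, k)) ≠ 0 := by
  have key : ∀ {a b c : ℕ}, a < b → b < c →
      orientDet (cakePt (r, a)) (cakePt (r, b)) (cakePt (r, c)) ≠ 0 := fun hab hbc =>
    (orientDet_same_neg r (chainParam_strictMono hab) (chainParam_strictMono hbc)).ne
  have swap : ∀ {p q s : ℝ × ℝ}, orientDet q p s ≠ 0 → orientDet p q s ≠ 0 := fun h h' =>
    h (by rw [orientDet_swap, h', neg_zero])
  have rot : ∀ {p q s : ℝ × ℝ}, orientDet q s p ≠ 0 → orientDet p q s ≠ 0 := fun h h' =>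
    h (by rw [orientDet_rotate, h'])
  rcases lt_or_gt_of_ne hij with h₁ | h₁ <;> rcases lt_or_gt_of_ne hjk with h₂ | h₂ <;>
    rcases lt_or_gt_of_ne hik with h₃ | h₃
  · exact key h₁ h₂
  · omega
  · exact swap (rot (key h₃ h₂))
  · exact rot (rot (key h₃ h₁))
  · exact swap (key h₁ h₃)
  · exact rot (key h₂ h₃)
  · omega
  · exact swap (rot (rot (key h₂ h₁)))

lemma orientDet_cakePt_pair_ne_zero {r s : Fin 3} (hrs : s ≠ r) {i j : ℕ} (k : ℕ) (hij : i ≠ j) :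
    orientDet (cakePt (r, i)) (cakePt (r, j)) (cakePt (s, k)) ≠ 0 := by
  have key : ∀ {a b : ℕ}, a < b →
      orientDet (cakePt (r, a)) (cakePt (r, b)) (cakePt (s, k)) ≠ 0 := by
    intro a b hab
    have hab' := chainParam_strictMono hab
    rcases fin_three_cases r s with rfl | rfl | rfl
    · exact absurd rfl hrs
    · have := orientDet_next_pos r (chainParam_mem a) (chainParam_mem b) (chainParam_mem k) hab'
      rw [← orientDet_rotate, orientDet_swap, neg_ne_zero, orientDet_rotate]
      exact this.ne'
    · have := orientDet_prev_pos r (chainParam_mem a) (chainParam_mem b) (chainParam_mem k) hab'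
      rw [← orientDet_rotate] at this
      exact this.ne'
  rcases lt_or_gt_of_ne hij with h | h
  · exact key h
  · rw [orientDet_swap, neg_ne_zero]
    exact key h

lemma orientDet_cakePt_ne_zero {p q r : Fin 3 × ℕ} (hpq : p ≠ q) (hpr : p ≠ r) (hqr : q ≠ r) :
    orientDet (cakePt p) (cakePt q) (cakePt r) ≠ 0 := by
  obtain ⟨a, i⟩ := p
  obtain ⟨b, j⟩ := q
  obtain ⟨c, k⟩ := r
  by_cases hab : b = a
  · subst hab
    by_cases hac : c = b
    · subst hac
      exact orientDet_cakePt_same_ne_zero c (fun h => hpq (h ▸ rfl)) (fun h => hpr (h ▸ rfl))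
        (fun h => hqr (h ▸ rfl))
    · exact orientDet_cakePt_pair_ne_zero hac k fun h => hpq (h ▸ rfl)
  · by_cases hac : c = a
    · subst hac
      rw [← orientDet_rotate, ← orientDet_rotate]
      exact orientDet_cakePt_pair_ne_zero hab j fun h => hpr (h ▸ rfl)
    · by_cases hbc : c = b
      · subst hbc
        rw [← orientDet_rotate]
        exact orientDet_cakePt_pair_ne_zero (Ne.symm hab) i fun h => hqr (h ▸ rfl)
      · rcases fin_three_cases a b with rfl | rfl | rfl
        · exact absurd rfl hab
        · rcases fin_three_cases a c with rfl | rfl | rfl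
          · exact absurd rfl hac
          · exact absurd rfl hbc
          · exact (orientDet_triple_pos a (chainParam_mem i) (chainParam_mem j)
              (chainParam_mem k)).ne'
        · rcases fin_three_cases a c with rfl | rfl | rfl
          · exact absurd rfl hac
          · rw [← orientDet_rotate, orientDet_swap, neg_ne_zero, orientDet_rotate]
            exact (orientDet_triple_pos a (chainParam_mem i) (chainParam_mem k)
              (chainParam_mem j)).ne'
          · exact absurd rfl hbc

/-! ### Bob's strategy -/

/-- With Alice to move on the points indexed by `S`, Bob wins by at least `v`. -/
def IndexAlice (S : Finset (Fin 3 × ℕ)) (v : ℤ) : Prop :=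
  AliceMargin cakeWeight (S.map cakeEmb) v

/-- With Bob to move on the points indexed by `S`, Bob wins by at least `v`. -/
def IndexBob (S : Finset (Fin 3 × ℕ)) (v : ℤ) : Prop :=
  BobMargin cakeWeight (S.map cakeEmb) v

lemma indexAlice_of_forall {S : Finset (Fin 3 × ℕ)} {v : ℤ} (hS : S.Nonempty)
    (h : ∀ a ∈ S, IndexExtremal S a → IndexBob (S.erase a) (v + (a.2 % 2 : ℕ))) :
    IndexAlice S v := by
  refine aliceMargin_of_forall (hS.map) fun p hp => ?_
  obtain ⟨a, ha, rfl⟩ := Finset.mem_map.1 (Finset.mem_of_mem_filter _ hp)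
  have := h a ha hp
  rwa [IndexBob, Finset.map_erase, ← cakeWeight_cakeEmb] at this

lemma IndexBob.of_move {S : Finset (Fin 3 × ℕ)} {v : ℤ} {b : Fin 3 × ℕ} (hb : IndexExtremal S b)
    (h : IndexAlice (S.erase b) (v - (b.2 % 2 : ℕ))) : IndexBob S v := by
  rw [IndexAlice, Finset.map_erase, ← cakeWeight_cakeEmb] at h
  exact BobMargin.of_move hb h

lemma index_margin_of_odd_extremal {S : Finset (Fin 3 × ℕ)}
    (h : ∀ q ∈ S, Odd q.2 → IndexExtremal S q) : IndexAlice S (-1) ∧ IndexBob S 0 := by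
  refine margin_of_red_extremal cakeWeight_le_one _ fun p hp hp1 => ?_
  obtain ⟨q, hq, rfl⟩ := Finset.mem_map.1 hp
  rw [cakeWeight_cakeEmb] at hp1
  exact h q hq (Nat.odd_iff.2 hp1)

/-- Only the chains `r` and `r + 1` are present, and what remains of the latter is an interval
with green ends. -/
def TwoChains (r : Fin 3) (S : Finset (Fin 3 × ℕ)) : Prop :=
  (∀ p ∈ S, p.1 = r ∨ p.1 = r + 1) ∧
    ∃ l m, Even l ∧ Even m ∧ ∀ i, (r + 1, i) ∈ S ↔ l ≤ i ∧ i ≤ m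

lemma fin_three_add_one_ne (r : Fin 3) : r + 1 ≠ r := by
  revert r; decide

lemma TwoChains.erase_left {r : Fin 3} {S : Finset (Fin 3 × ℕ)} (h : TwoChains r S) (i : ℕ) :
    TwoChains r (S.erase (r, i)) := by
  obtain ⟨hS, l, m, hl, hm, hlm⟩ := h
  exact ⟨fun p hp => hS p (Finset.mem_of_mem_erase hp), l, m, hl, hm, by simpa using hlm⟩

/-- When Alice takes a point of chain `r + 1` while chain `r` is present, Bob can answer so that
the structure is preserved. -/
lemma TwoChains.erase_right {r : Fin 3} {S : Finset (Fin 3 × ℕ)} (h : TwoChains r S) {b j : ℕ}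
    (hb : (r, b) ∈ S) (hj : (r + 1, j) ∈ S) (hex : IndexExtremal S (r + 1, j)) :
    Even j ∧ (TwoChains r (S.erase (r + 1, j)) ∨
      ∃ c, Odd c ∧ (r + 1, c) ∈ S.erase (r + 1, j) ∧
        IndexExtremal (S.erase (r + 1, j)) (r + 1, c) ∧
        TwoChains r ((S.erase (r + 1, j)).erase (r + 1, c))) := by
  obtain ⟨hS, l, m, hl, hm, hlm⟩ := h
  have hj' := (hlm j).1 hj
  have hS' : ∀ p ∈ S.erase (r + 1, j), p.1 = r ∨ p.1 = r + 1 :=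
    fun p hp => hS p (Finset.mem_of_mem_erase hp)
  have hend : j = l ∨ j = m := by
    by_contra! hne
    exact not_indexExtremal_of_between (i := l) (k := m) (by omega) (by omega)
      ((hlm l).2 (by omega)) ((hlm m).2 (by omega)) hb hex
  refine ⟨by rcases hend with rfl | rfl <;> assumption, ?_⟩
  rcases eq_or_ne l m with hEq | hne
  · refine .inl ⟨hS', l + 2, m, by simpa [parity_simps] using hl, hm, fun i => ?_⟩
    simp only [Finset.mem_erase, ne_eq, Prod.mk.injEq, true_and, hlm]
    omega
  · right
    rw [Nat.even_iff] at hl hm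
    have hmem : ∀ i, (r + 1, i) ∈ S.erase (r + 1, j) ↔ i ≠ j ∧ l ≤ i ∧ i ≤ m := fun i => by
      simp [hlm]
    rcases hend with rfl | rfl
    · refine ⟨j + 1, Nat.odd_iff.2 (by omega), (hmem _).2 (by omega), ?_, ?_⟩
      · refine indexExtremal_head ((hmem _).2 (by omega)) fun i hi => ?_
        have := (hmem i).1 hi
        omega
      · refine ⟨fun p hp => hS' p (Finset.mem_of_mem_erase hp), j + 2, m,
          Nat.even_iff.2 (by omega), Nat.even_iff.2 hm, fun i => ?_⟩
        rw [Finset.mem_erase, hmem]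
        simp only [ne_eq, Prod.mk.injEq, true_and]
        omega
    · refine ⟨j - 1, Nat.odd_iff.2 (by omega), (hmem _).2 (by omega), ?_, ?_⟩
      · refine indexExtremal_tail ((hmem _).2 (by omega)) hS' fun i hi => ?_
        have := (hmem i).1 hi
        omega
      · refine ⟨fun p hp => hS' p (Finset.mem_of_mem_erase hp), l, j - 2,
          Nat.even_iff.2 hl, Nat.even_iff.2 (by omega), fun i => ?_⟩
        rw [Finset.mem_erase, hmem]
        simp only [ne_eq, Prod.mk.injEq, true_and]
        omega

lemma IndexAlice.mono {S : Finset (Fin 3 × ℕ)} {v v' : ℤ} (h : IndexAlice S v) (hv : v' ≤ v) :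
    IndexAlice S v' :=
  AliceMargin.mono h hv

lemma IndexBob.mono {S : Finset (Fin 3 × ℕ)} {v v' : ℤ} (h : IndexBob S v) (hv : v' ≤ v) :
    IndexBob S v' :=
  BobMargin.mono h hv

lemma TwoChains.margin {r : Fin 3} (S : Finset (Fin 3 × ℕ)) (h : TwoChains r S) :
    IndexAlice S (-2) ∧ IndexBob S (-1) ∧
      ((∀ i, (r, i) ∈ S → Even i) → IndexAlice S (-1)) := by
  induction S using Finset.strongInduction with
  | H S ih =>
    by_cases hr : ∃ b, (r, b) ∈ S
    · obtain ⟨b, hb⟩ := hr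
      have left : ∀ i, (r, i) ∈ S → _ := fun i hi =>
        ih _ (Finset.erase_ssubset hi) (h.erase_left i)
      have reply : ∀ a ∈ S, IndexExtremal S a →
          IndexBob (S.erase a) (-1) ∧ (a.1 = r + 1 → Even a.2) := by
        rintro ⟨s, j⟩ ha hex
        rcases h.1 _ ha with hs | hs <;> obtain rfl : s = _ := hs
        · exact ⟨(left j ha).2.1, fun he => absurd he.symm (fin_three_add_one_ne s)⟩
        · obtain ⟨hj, h' | ⟨c, hc, hcS, hcex, h'⟩⟩ := h.erase_right hb ha hex
          · exact ⟨(ih _ (Finset.erase_ssubset ha) h').2.1, fun _ => hj⟩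
          · refine ⟨.of_move hcex ?_, fun _ => hj⟩
            rw [Nat.odd_iff.1 hc]
            exact (ih _ ((Finset.erase_ssubset hcS).trans (Finset.erase_ssubset ha)) h').1
      refine ⟨indexAlice_of_forall ⟨_, hb⟩ fun a ha hex => (reply a ha hex).1.mono (by omega),
        ?_, fun heven => indexAlice_of_forall ⟨_, hb⟩ fun a ha hex => ?_⟩
      · by_cases hodd : ∃ i, (r, i) ∈ S ∧ Odd i
        · obtain ⟨i, hi, hio⟩ := hodd
          refine .of_move (indexExtremal_tangent hi h.1) ?_
          rw [Nat.odd_iff.1 hio]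
          exact (left i hi).1
        · have heven : ∀ i, (r, i) ∈ S → Even i := fun i hi =>
            Nat.not_odd_iff_even.1 fun ho => hodd ⟨i, hi, ho⟩
          refine .of_move (indexExtremal_tangent hb h.1) ?_
          rw [Nat.even_iff.1 (heven b hb)]
          exact (left b hb).2.2 fun i hi => heven i (Finset.mem_of_mem_erase hi)
      · have ha2 : Even a.2 := by
          rcases h.1 a ha with hs | hs
          · exact heven a.2 (hs ▸ ha)
          · exact (reply a ha hex).2 hs
        rw [Nat.even_iff.1 ha2]
        exact (reply a ha hex).1
    · have hS : ∀ p ∈ S, p.1 = r + 1 := fun p hp =>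
        (h.1 p hp).resolve_left fun he => hr ⟨p.2, he ▸ hp⟩
      have key := index_margin_of_odd_extremal (S := S) fun q hq _ =>
        indexExtremal_tangent (r := q.1) (i := q.2) hq
          fun p hp => .inl ((hS p hp).trans (hS q hq).symm)
      exact ⟨key.1.mono (by norm_num), key.2.mono (by norm_num), fun _ => key.1⟩

/-- While all chains are present, Bob answers on the chain from which Alice takes. -/
lemma three_chains_margin (k : ℕ) (S : Finset (Fin 3 × ℕ)) (s : Fin 3 → ℕ) (m : ℕ)
    (heven : ∀ r, Even (s r)) (hm : ∀ r, s r + 2 * m ≤ 2 * k)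
    (hS : ∀ r i, (r, i) ∈ S ↔ s r ≤ i ∧ i ≤ 2 * k) : IndexAlice S (m - 1) := by
  induction S using Finset.strongInduction generalizing s m with
  | H S ih =>
    have hhead : ∀ r, (r, s r) ∈ S := fun r => (hS r _).2 ⟨le_rfl, by have := hm r; omega⟩
    refine indexAlice_of_forall ⟨_, hhead 0⟩ ?_
    rintro ⟨r, i⟩ ha hex
    have hi := (hS r i).1 ha
    obtain rfl : i = s r := by
      by_contra hne
      exact not_indexExtremal_of_three (lt_of_le_of_ne hi.1 (Ne.symm hne)) (hhead r)
        (hhead (r + 1)) (hhead (r + 2)) hex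
    have hmr := hm r
    have her := Nat.even_iff.1 (heven r)
    simp only [her, Nat.cast_zero, add_zero]
    rcases eq_or_ne (s r) (2 * k) with hend | hend
    · have htwo : TwoChains (r + 1) (S.erase (r, s r)) := by
        refine ⟨?_, s (r + 1 + 1), 2 * k, heven _, even_two_mul k, fun i => ?_⟩
        · rintro ⟨q, j⟩ hq
          rw [Finset.mem_erase, hS] at hq
          rcases fin_three_cases r q with rfl | rfl | rfl
          · have : j = s q := by omega
            exact absurd (by rw [this]) hq.1
          · exact .inl rfl
          · right
            change r + 2 = r + 1 + 1
            clear * -; revert r; decide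
        · rw [Finset.mem_erase, hS]
          have : r + 1 + 1 ≠ r := by clear * -; revert r; decide
          simp [this]
      exact htwo.margin.2.1.mono (by omega)
    · have hmem : ∀ i, (r, i) ∈ S.erase (r, s r) ↔ s r + 1 ≤ i ∧ i ≤ 2 * k := fun i => by
        rw [Finset.mem_erase, hS]
        simp only [ne_eq, Prod.mk.injEq, true_and]
        omega
      have hnext : (r, s r + 1) ∈ S.erase (r, s r) := (hmem _).2 (by omega)
      refine .of_move (indexExtremal_head hnext fun j hj => ((hmem j).1 hj).1) ?_
      have hodd : (s r + 1) % 2 = 1 := by omega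
      simp only [hodd]
      refine (ih _ ((Finset.erase_ssubset hnext).trans (Finset.erase_ssubset ha))
        (Function.update s r (s r + 2)) (m - 1) (fun q => ?_) (fun q => ?_) fun q i => ?_).mono
        (by push_cast; omega)
      · rcases eq_or_ne q r with rfl | hq
        · simpa [parity_simps] using heven q
        · simpa [hq] using heven q
      · have := hm q
        rcases eq_or_ne q r with rfl | hq
        · simp only [Function.update_self]; omega
        · simp only [Function.update_of_ne hq]; omega
      · rw [Finset.mem_erase, Finset.mem_erase, hS]
        rcases eq_or_ne q r with rfl | hq
        · simp only [Function.update_self, ne_eq, Prod.mk.injEq, true_and]; omega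
        · simp [hq]

/-- For every `x ∈ ℕ` there is an odd-sized cake `𝒞` with
`M(𝒞) − (R(𝒞) − M(𝒞)) ≥ x`: Bob can win by an arbitrarily large margin. -/
theorem statement5 (x : ℕ) :
    ∃ (C : Finset (ℝ × ℝ)) (w : ℝ × ℝ → ℕ),
      (∀ p, w p ≤ 1) ∧ GenPos (↑C : Set (ℝ × ℝ)) ∧ Odd C.card ∧
      (x : ℤ) ≤ (gameM w C : ℤ) -
        (((C.filter (fun p => w p = 1)).card : ℤ) - (gameM w C : ℤ)) := by
  set S : Finset (Fin 3 × ℕ) := Finset.univ ×ˢ Finset.range (2 * (x + 1) + 1) with hS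
  refine ⟨S.map cakeEmb, cakeWeight, cakeWeight_le_one, ?_, ?_, ?_⟩
  · intro p hp q hq r hr hpq hpr hqr
    obtain ⟨p, -, rfl⟩ := Finset.mem_map.1 (Finset.mem_coe.1 hp)
    obtain ⟨q, -, rfl⟩ := Finset.mem_map.1 (Finset.mem_coe.1 hq)
    obtain ⟨r, -, rfl⟩ := Finset.mem_map.1 (Finset.mem_coe.1 hr)
    exact orientDet_cakePt_ne_zero (fun h => hpq (h ▸ rfl)) (fun h => hpr (h ▸ rfl))
      (fun h => hqr (h ▸ rfl))
  · rw [Finset.card_map, hS, Finset.card_product, Finset.card_univ, Fintype.card_fin,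
      Finset.card_range, Nat.odd_iff]
    omega
  · have h := three_chains_margin (x + 1) S 0 (x + 1) (by simp) (by simp)
      (fun r i => by simp [hS])
    have hcard : ((S.map cakeEmb).filter (fun p => cakeWeight p = 1)).card =
        ∑ p ∈ S.map cakeEmb, cakeWeight p := by
      rw [Finset.card_filter]
      refine Finset.sum_congr rfl fun p _ => ?_
      have := cakeWeight_le_one p
      split_ifs <;> omega
    unfold IndexAlice AliceMargin at h
    rw [hcard]
    push_cast at h ⊢
    linarith

end
end
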